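/- Let G be a bounded Petri game with one system player. If Player 0 has a winning strategy in the graph game Graph'(G), then G has a winning, deadlock-avoiding strategy. -/

import Mathlib

/-- A Petri net over places `P` and transitions `T`: each transition has a
nonempty finite multiset precondition and postcondition (encoding the flow
relation `F`), and there is a finite initial marking. -/
structure PetriNet (P T : Type) where
  pre  : T → Multiset P
  post : T → Multiset P
  init : Multiset P
  pre_ne  : ∀ t, pre t ≠ 0
  post_ne : ∀ t, post t ≠ 0

namespace PetriNet

variable {P T : Type}

/-- A transition `t` is enabled in a marking `M` if `pre t ⊆ M`. -/
def Enabled (N : PetriNet P T) (M : Multiset P) (t : T) : Prop :=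
  N.pre t ≤ M

/-- `M →t M'`: firing an enabled transition. -/
def Fires [DecidableEq P] (N : PetriNet P T) (M : Multiset P) (t : T) (M' : Multiset P) : Prop :=
  N.pre t ≤ M ∧ M' = M - N.pre t + N.post t

def Step [DecidableEq P] (N : PetriNet P T) (M M' : Multiset P) : Prop :=
  ∃ t, N.Fires M t M'

/-- A marking is reachable if obtained from the initial marking by firing a
finite sequence of transitions. -/
def Reachable [DecidableEq P] (N : PetriNet P T) (M : Multiset P) : Prop :=
  Relation.ReflTransGen N.Step N.init M

/-- The flow relation on nodes (places ⊕ transitions). -/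
def Flow (N : PetriNet P T) : P ⊕ T → P ⊕ T → Prop
  | Sum.inl p, Sum.inr t => p ∈ N.pre t
  | Sum.inr t, Sum.inl p => p ∈ N.post t
  | _, _ => False

/-- `<` : transitive closure of the flow relation. -/
def CLt (N : PetriNet P T) : P ⊕ T → P ⊕ T → Prop := Relation.TransGen N.Flow

/-- `≤` : reflexive-transitive closure of the flow relation. -/
def CLe (N : PetriNet P T) : P ⊕ T → P ⊕ T → Prop := Relation.ReflTransGen N.Flow

/-- Nodes `x`, `y` are in conflict if from some place `q` (distinct from both)
one can reach `x` and `y` via two different outgoing transitions of `q`. -/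
def Conflict (N : PetriNet P T) (x y : P ⊕ T) : Prop :=
  ∃ q : P, Sum.inl q ≠ x ∧ Sum.inl q ≠ y ∧
    ∃ t₁ t₂ : T, t₁ ≠ t₂ ∧ q ∈ N.pre t₁ ∧ q ∈ N.pre t₂ ∧
      N.CLe (Sum.inr t₁) x ∧ N.CLe (Sum.inr t₂) y

/-- Concurrent: neither causally related nor in conflict. -/
def Concurrent (N : PetriNet P T) (x y : P ⊕ T) : Prop :=
  ¬ N.CLe x y ∧ ¬ N.CLe y x ∧ ¬ N.Conflict x y

/-- Occurrence net: pre/postconditions are sets, every place has at most one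
incoming transition, the initial marking is the set of places without incoming
transitions, the inverse flow relation is well-founded, and no transition is in
self-conflict. -/
structure IsOccurrence (N : PetriNet P T) : Prop where
  pre_nodup : ∀ t, (N.pre t).Nodup
  post_nodup : ∀ t, (N.post t).Nodup
  unique_pre : ∀ p : P, ∀ t₁ t₂ : T, p ∈ N.post t₁ → p ∈ N.post t₂ → t₁ = t₂
  init_nodup : N.init.Nodup
  mem_init : ∀ p : P, p ∈ N.init ↔ ∀ t : T, p ∉ N.post t
  wf : WellFounded N.Flow
  no_self_conflict : ∀ t : T, ¬ N.Conflict (Sum.inr t) (Sum.inr t)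

def PairwiseConcurrent (N : PetriNet P T) (C : Set P) : Prop :=
  ∀ p ∈ C, ∀ q ∈ C, p ≠ q → N.Concurrent (Sum.inl p) (Sum.inl q)

/-- A cut: a maximal set of pairwise concurrent places. -/
def IsCut (N : PetriNet P T) (C : Set P) : Prop :=
  N.PairwiseConcurrent C ∧ ∀ D : Set P, N.PairwiseConcurrent D → C ⊆ D → D = C

end PetriNet

/-- `(N₁, fP, fT)` is an initial branching process of `N₂`: `N₁` is an
occurrence net, `(fP, fT)` is an initial homomorphism, and transitions with the
same precondition and the same image coincide. -/
structure IsBranchingProcess {P₁ T₁ P₂ T₂ : Type}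
    (N₁ : PetriNet P₁ T₁) (N₂ : PetriNet P₂ T₂)
    (fP : P₁ → P₂) (fT : T₁ → T₂) : Prop where
  occ : N₁.IsOccurrence
  map_pre : ∀ t, (N₁.pre t).map fP = N₂.pre (fT t)
  map_post : ∀ t, (N₁.post t).map fP = N₂.post (fT t)
  map_init : N₁.init.map fP = N₂.init
  trans_inj : ∀ t₁ t₂, N₁.pre t₁ = N₁.pre t₂ → fT t₁ = fT t₂ → t₁ = t₂

/-- A Petri game: the places of the underlying net are partitioned into system
places (`isSystem`) and environment places, together with a set of bad
markings. -/
structure PetriGame (P T : Type) where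
  net : PetriNet P T
  isSystem : P → Prop
  bad : Set (Multiset P)

namespace PetriGame

variable {P T : Type}

/-- A purely environmental transition: no system place in its precondition. -/
def PureEnv (G : PetriGame P T) (t : T) : Prop := ∀ p ∈ G.net.pre t, ¬ G.isSystem p

/-- A system transition: some system place in its precondition. -/
def SysTrans (G : PetriGame P T) (t : T) : Prop := ∃ p ∈ G.net.pre t, G.isSystem p

/-- The outgoing transitions of a place `s`. -/
def postOf (G : PetriGame P T) (s : P) : Set T := {t | s ∈ G.net.pre t}

/-- `G` has one system player: every reachable marking contains exactly one
system place (one system token). -/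
def OneSystemPlayer [DecidableEq P] (G : PetriGame P T) : Prop :=
  ∀ M, G.net.Reachable M → ∃ s : P, G.isSystem s ∧ M.count s = 1 ∧
    ∀ s' : P, G.isSystem s' → s' ∈ M → s' = s

/-- `G` is bounded: `k`-bounded for some `k ≥ 1`. -/
def Bounded [DecidableEq P] (G : PetriGame P T) : Prop :=
  ∃ k : ℕ, 1 ≤ k ∧ ∀ M, G.net.Reachable M → ∀ p : P, M.count p ≤ k

/-- A winning, deadlock-avoiding strategy for the Petri game `G`: an initial
branching process `(N', fP, fT)` of the underlying net satisfying justified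
refusal, safety, determinism and deadlock avoidance. -/
structure IsWinningStrategy [DecidableEq P] (G : PetriGame P T) {P' T' : Type}
    [DecidableEq P'] (N' : PetriNet P' T') (fP : P' → P) (fT : T' → T) : Prop where
  bp : IsBranchingProcess N' G.net fP fT
  justified_refusal : ∀ (S : Multiset P') (t' : T),
      S.Nodup →
      (∀ p ∈ S, ∀ q ∈ S, p ≠ q → N'.Concurrent (Sum.inl p) (Sum.inl q)) →
      S.map fP = G.net.pre t' →
      (¬ ∃ t : T', fT t = t' ∧ N'.pre t = S) →
      ∃ s ∈ S, G.isSystem (fP s) ∧ ∀ t : T', s ∈ N'.pre t → fT t ≠ t'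
  safety : ∀ M, N'.Reachable M → M.map fP ∉ G.bad
  determinism : ∀ s : P', G.isSystem (fP s) → ∀ M, N'.Reachable M → s ∈ M →
      ∀ t₁ t₂ : T', s ∈ N'.pre t₁ → s ∈ N'.pre t₂ →
        N'.Enabled M t₁ → N'.Enabled M t₂ → t₁ = t₂
  deadlock_avoidance : ∀ M, N'.Reachable M →
      (∃ t : T, G.net.Enabled (M.map fP) t) → ∃ t' : T', N'.Enabled M t'

/-- `G` admits a winning, deadlock-avoiding strategy. -/
def HasWinningStrategy [DecidableEq P] (G : PetriGame P T) : Prop :=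
  ∃ (P' T' : Type) (_ : DecidableEq P') (N' : PetriNet P' T')
    (fP : P' → P) (fT : T' → T), IsWinningStrategy G N' fP fT

end PetriGame

/-- Play prefixes (most recent vertex first) consistent with a Player-0
strategy `σ` in a graph game: starting at `init`, Player 0 moves to `σ`'s
choice at her vertices, and Player 1 may move along any edge at hers. -/
inductive ConsistentPlay {V : Type} (edge : V → V → Prop) (isP0 : V → Prop)
    (σ : List V → V) (init : V) : List V → Prop
  | base : ConsistentPlay edge isP0 σ init [init]
  | stepP0 {h : List V} {v : V} :
      ConsistentPlay edge isP0 σ init (v :: h) → isP0 v → edge v (σ (v :: h)) →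
      ConsistentPlay edge isP0 σ init (σ (v :: h) :: v :: h)
  | stepP1 {h : List V} {v w : V} :
      ConsistentPlay edge isP0 σ init (v :: h) → ¬ isP0 v → edge v w →
      ConsistentPlay edge isP0 σ init (w :: v :: h)

/-- Player 0 has a winning strategy in the graph game `(edge, isP0, bad, init)`:
a strategy that always proposes an actual successor at every Player-0 vertex it
reaches (each Player-0 node of the strategy tree has one child, labeled with a
successor) and such that no consistent play ever visits a bad vertex. -/
def WinningP0 {V : Type} (edge : V → V → Prop) (isP0 : V → Prop)
    (bad : V → Prop) (init : V) : Prop :=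
  ∃ σ : List V → V,
    (∀ (h : List V) (v : V), ConsistentPlay edge isP0 σ init (v :: h) → isP0 v →
        edge v (σ (v :: h))) ∧
    (∀ (l : List V) (v : V), ConsistentPlay edge isP0 σ init l → v ∈ l → ¬ bad v)

/-- Vertices of `Graph(G)`: a marking together with either `⊤` (`none`,
Player 0 to choose a commitment) or a commitment `c` (`some c`, Player 1). -/
abbrev GVertex (P T : Type) := Multiset P × Option (Set T)

/-- Edges of `Graph(G)`: (E1) Player 0 picks a commitment `c ⊆ post(s_M)`;
(E2) Player 1 fires a purely environmental transition; (E3) Player 1 fires a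
system transition from the commitment. -/
inductive GEdge {P T : Type} [DecidableEq P] (G : PetriGame P T) :
    GVertex P T → GVertex P T → Prop
  | e1 {M : Multiset P} {c : Set T} {s : P} :
      G.isSystem s → s ∈ M → c ⊆ G.postOf s →
      GEdge G (M, none) (M, some c)
  | e2 {M M' : Multiset P} {c : Set T} {t : T} :
      G.PureEnv t → G.net.Fires M t M' →
      GEdge G (M, some c) (M', some c)
  | e3 {M M' : Multiset P} {c : Set T} {t : T} :
      G.SysTrans t → t ∈ c → G.net.Fires M t M' →
      GEdge G (M, some c) (M', none)

/-- Bad vertices of `Graph(G)`: (X1) bad marking, (X2a) two distinct committed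
transitions enabled, (X2b) a committed enabled transition with
`0 < pre(t)(p) < M(p)` for some place `p`, (X3) deadlock: some transition of
the net is enabled but all enabled ones are system transitions outside the
commitment. -/
def GBad {P T : Type} [DecidableEq P] (G : PetriGame P T) : GVertex P T → Prop :=
  fun v => match v with
  | (_, none) => False
  | (M, some c) =>
      M ∈ G.bad ∨
      (∃ t₁ ∈ c, ∃ t₂ ∈ c, t₁ ≠ t₂ ∧ G.net.Enabled M t₁ ∧ G.net.Enabled M t₂) ∨
      (∃ t ∈ c, G.net.Enabled M t ∧
        ∃ p : P, 0 < (G.net.pre t).count p ∧ (G.net.pre t).count p < M.count p) ∨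
      ((∃ t : T, G.net.Enabled M t) ∧
        ∀ t : T, G.net.Enabled M t → G.SysTrans t ∧ t ∉ c)

/-- Player 0 has a winning strategy in `Graph(G)`. -/
def PetriGame.HasWinningGraphStrategy {P T : Type} [DecidableEq P]
    (G : PetriGame P T) : Prop :=
  WinningP0 (GEdge G) (fun v => v.2 = none) (GBad G) (G.net.init, none)

/-- Vertices of `Graph'(G)`: marking, commitment (or `⊤`), and responsibility
multiset. -/
abbrev GVertex' (P T : Type) := Multiset P × Option (Set T) × Multiset P

/-- Edges of `Graph'(G)`: (E'1) Player 0 picks a commitment; (E'2) Player 1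
fires a purely environmental transition `t`, updating the responsibility
multiset to `R - pre(t) + {o}` for a chosen `o ∈ post(t)`; (E'3) Player 1 fires
a committed system transition `t` with `R ⊆ pre(t)`, resetting the
responsibility multiset to the system place of the new marking. -/
inductive GEdge' {P T : Type} [DecidableEq P] (G : PetriGame P T) :
    GVertex' P T → GVertex' P T → Prop
  | e1 {M : Multiset P} {c : Set T} {s : P} :
      G.isSystem s → s ∈ M → c ⊆ G.postOf s →
      GEdge' G (M, none, {s}) (M, some c, {s})
  | e2 {M M' : Multiset P} {c : Set T} {R : Multiset P} {t : T} {o : P} :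
      G.PureEnv t → G.net.Fires M t M' → o ∈ G.net.post t →
      GEdge' G (M, some c, R) (M', some c, R - G.net.pre t + {o})
  | e3 {M M' : Multiset P} {c : Set T} {R : Multiset P} {t : T} {s' : P} :
      G.SysTrans t → t ∈ c → G.net.Fires M t M' → R ≤ G.net.pre t →
      G.isSystem s' → s' ∈ M' →
      GEdge' G (M, some c, R) (M', none, {s'})

/-- Bad vertices of `Graph'(G)`: `(M, c, R)` is bad iff `(M, c)` is bad in
`Graph(G)`. -/
def GBad' {P T : Type} [DecidableEq P] (G : PetriGame P T) : GVertex' P T → Prop :=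
  fun v => GBad G (v.1, v.2.1)

/-- Player 0 has a winning strategy in `Graph'(G)` (the initial vertex is
`(In, ⊤, {s_In})` where `s_In` is the system place of the initial marking). -/
def PetriGame.HasWinningGraphStrategy' {P T : Type} [DecidableEq P]
    (G : PetriGame P T) : Prop :=
  ∃ s₀ : P, G.isSystem s₀ ∧ s₀ ∈ G.net.init ∧
    WinningP0 (GEdge' G) (fun v => v.2.1 = none) (GBad' G)
      (G.net.init, none, ({s₀} : Multiset P))

/-- Places of the unfolding of a net: an initial token, or a token produced by a transition
together with the list of tokens it consumed. -/
inductive Token (P T : Type) : Type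
  | init (x : P × ℕ) : Token P T
  | post (t : T) (l : List (Token P T)) (x : P × ℕ) : Token P T

namespace Token

variable {P T : Type}

/-- The place of the original net that a token lies on. -/
def lab : Token P T → P
  | init x => x.1
  | post _ _ x => x.1

noncomputable instance : DecidableEq (Token P T) := Classical.decEq _

end Token

/-- Events of the unfolding: a transition together with the set of tokens it consumes. -/
abbrev Event (P T : Type) : Type := T × Finset (Token P T)

namespace Event

variable {P T : Type}

noncomputable instance : DecidableEq (Event P T) := Classical.decEq _

/-- A size of events compatible with the size of tokens. -/
noncomputable def rank (e : Event P T) : ℕ := sizeOf e.2.toList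

theorem sizeOf_lt_rank {e : Event P T} {q : Token P T} (h : q ∈ e.2) : sizeOf q < e.rank :=
  List.sizeOf_lt_of_mem (Finset.mem_toList.2 h)

end Event

namespace Token

variable {P T : Type}

/-- The events in the causal past of a token. -/
noncomputable def past : Token P T → Finset (Event P T)
  | init _ => ∅
  | post t l _ => insert (t, l.toFinset) (l.attach.toFinset.biUnion fun q => past q.1)
termination_by q => sizeOf q
decreasing_by
  have := List.sizeOf_lt_of_mem q.2
  simp only [post.sizeOf_spec]
  omega

end Token

namespace PetriNet

variable {P T : Type} [DecidableEq P] (N : PetriNet P T)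

/-- The tokens of the initial marking. -/
noncomputable def initTokens : Finset (Token P T) := N.init.toEnumFinset.image Token.init

/-- The tokens produced by an event. -/
noncomputable def postTokens (e : Event P T) : Finset (Token P T) :=
  (N.post e.1).toEnumFinset.image (Token.post e.1 e.2.toList)

/-- The tokens which are initial or produced by an event of `C`. -/
noncomputable def tokens (C : Finset (Event P T)) : Finset (Token P T) :=
  N.initTokens ∪ C.biUnion N.postTokens

/-- The tokens present after all the events of `C` have occurred. -/
noncomputable def cut (C : Finset (Event P T)) : Finset (Token P T) :=
  N.tokens C \ C.biUnion Prod.snd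

/-- The marking of the original net underlying the cut of `C`. -/
noncomputable def cutMarking (C : Finset (Event P T)) : Multiset P :=
  (N.cut C).val.map Token.lab

/-- The causal past of an event, the event itself excluded. -/
noncomputable def _root_.Event.past (e : Event P T) : Finset (Event P T) :=
  e.2.biUnion Token.past

variable {N}

theorem mem_tokens {C : Finset (Event P T)} {q : Token P T} :
    q ∈ N.tokens C ↔ q ∈ N.initTokens ∨ ∃ e ∈ C, q ∈ N.postTokens e := by
  simp [tokens]

theorem mem_cut {C : Finset (Event P T)} {q : Token P T} :
    q ∈ N.cut C ↔ q ∈ N.tokens C ∧ ∀ e ∈ C, q ∉ e.2 := by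
  rw [cut, Finset.mem_sdiff, Finset.mem_biUnion]
  push Not
  rfl

theorem map_lab_initTokens : N.initTokens.val.map Token.lab = N.init := by
  rw [initTokens, Finset.image_val_of_injOn (fun a _ b _ h => by simpa using h),
    Multiset.map_map]
  exact Multiset.map_toEnumFinset_fst _

theorem map_lab_postTokens (e : Event P T) :
    (N.postTokens e).val.map Token.lab = N.post e.1 := by
  rw [postTokens, Finset.image_val_of_injOn (fun a _ b _ h => by simpa using h),
    Multiset.map_map]
  exact Multiset.map_toEnumFinset_fst _

theorem postTokens_nonempty (e : Event P T) : (N.postTokens e).Nonempty := by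
  rw [Finset.nonempty_iff_ne_empty]
  intro h
  apply N.post_ne e.1
  rw [← map_lab_postTokens, h]
  rfl

theorem eq_of_mem_postTokens {e e' : Event P T} {q : Token P T} (h : q ∈ N.postTokens e)
    (h' : q ∈ N.postTokens e') : e = e' := by
  simp only [postTokens, Finset.mem_image] at h h'
  obtain ⟨x, -, rfl⟩ := h
  obtain ⟨y, -, hy⟩ := h'
  simp only [Token.post.injEq] at hy
  refine Prod.ext hy.1.symm ?_
  rw [← e.2.toList_toFinset, ← hy.2.1, Finset.toList_toFinset]

theorem notMem_postTokens_of_mem_initTokens {e : Event P T} {q : Token P T}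
    (h : q ∈ N.initTokens) : q ∉ N.postTokens e := by
  simp only [postTokens, initTokens, Finset.mem_image] at h ⊢
  obtain ⟨x, -, rfl⟩ := h
  simp

theorem rank_lt_sizeOf {e : Event P T} {q : Token P T} (h : q ∈ N.postTokens e) :
    e.rank < sizeOf q := by
  simp only [postTokens, Finset.mem_image] at h
  obtain ⟨x, -, rfl⟩ := h
  simp only [Event.rank, Token.post.sizeOf_spec]
  omega

theorem past_of_mem_initTokens {q : Token P T} (h : q ∈ N.initTokens) : q.past = ∅ := by
  simp only [initTokens, Finset.mem_image] at h
  obtain ⟨x, -, rfl⟩ := h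
  rw [Token.past]

theorem past_of_mem_postTokens {e : Event P T} {q : Token P T} (h : q ∈ N.postTokens e) :
    q.past = insert e e.past := by
  simp only [postTokens, Finset.mem_image] at h
  obtain ⟨x, -, rfl⟩ := h
  rw [Token.past, Finset.toList_toFinset]
  congr 1
  ext a
  simp [Event.past]

/-- A configuration: a causally closed and conflict-free finite set of admissible events. -/
structure IsConfig (N : PetriNet P T) (ok : Event P T → Prop) (C : Finset (Event P T)) :
    Prop where
  map_lab : ∀ e ∈ C, e.2.val.map Token.lab = N.pre e.1
  ok : ∀ e ∈ C, ok e
  closed : ∀ e ∈ C, ∀ q ∈ e.2, q ∈ N.tokens C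
  conflict_free : ∀ e₁ ∈ C, ∀ e₂ ∈ C, ∀ q ∈ e₁.2, q ∈ e₂.2 → e₁ = e₂

variable {ok : Event P T → Prop} {C D : Finset (Event P T)}

theorem tokens_mono (h : D ⊆ C) : N.tokens D ⊆ N.tokens C :=
  Finset.union_subset_union_right (Finset.biUnion_subset_biUnion_of_subset_left _ h)

theorem cut_subset_tokens : N.cut C ⊆ N.tokens C := Finset.sdiff_subset

theorem isConfig_empty : N.IsConfig ok ∅ := by
  constructor <;> simp

theorem cut_empty : N.cut ∅ = N.initTokens := by
  simp [cut, tokens]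

theorem IsConfig.token_induction (hC : N.IsConfig ok C) {p : Token P T → Prop}
    (init : ∀ q ∈ N.initTokens, p q)
    (step : ∀ e ∈ C, (∀ r ∈ e.2, p r) → ∀ q ∈ N.postTokens e, p q) :
    ∀ q ∈ N.tokens C, p q := by
  intro q
  induction hn : sizeOf q using Nat.strong_induction_on generalizing q with
  | _ n ih =>
    subst hn
    intro hq
    rcases mem_tokens.1 hq with h | ⟨e, he, h⟩
    · exact init q h
    · refine step e he (fun r hr => ?_) q h
      exact ih _ ((Event.sizeOf_lt_rank hr).trans (rank_lt_sizeOf h)) r rfl (hC.closed e he r hr)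

theorem IsConfig.past_subset (hC : N.IsConfig ok C) {q : Token P T} (hq : q ∈ N.tokens C) :
    q.past ⊆ C := by
  refine hC.token_induction (p := fun q => q.past ⊆ C) (fun q h => ?_) (fun e he ih q h => ?_) q hq
  · simp [past_of_mem_initTokens h]
  · rw [past_of_mem_postTokens h]
    exact Finset.insert_subset he (Finset.biUnion_subset.2 ih)

theorem IsConfig.eventPast_subset (hC : N.IsConfig ok C) {e : Event P T} (he : e ∈ C) :
    e.past ⊆ C :=
  Finset.biUnion_subset.2 fun q hq => hC.past_subset (hC.closed e he q hq)

theorem IsConfig.past_trans (hC : N.IsConfig ok C) {q : Token P T} (hq : q ∈ N.tokens C) :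
    ∀ e ∈ q.past, e.past ⊆ q.past := by
  refine hC.token_induction (p := fun q => ∀ e ∈ q.past, e.past ⊆ q.past) (fun q h => ?_)
    (fun e he ih q h => ?_) q hq
  · simp [past_of_mem_initTokens h]
  · rw [past_of_mem_postTokens h]
    intro e' he'
    rcases Finset.mem_insert.1 he' with rfl | he'
    · exact Finset.subset_insert _ _
    · obtain ⟨r, hr, he'⟩ := Finset.mem_biUnion.1 he'
      exact (ih r hr e' he').trans
        ((Finset.subset_biUnion_of_mem Token.past hr).trans (Finset.subset_insert _ _))

theorem IsConfig.rank_lt_of_mem_past (hC : N.IsConfig ok C) {q : Token P T}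
    (hq : q ∈ N.tokens C) : ∀ e ∈ q.past, e.rank < sizeOf q := by
  refine hC.token_induction (p := fun q => ∀ e ∈ q.past, e.rank < sizeOf q) (fun q h => ?_)
    (fun e he ih q h => ?_) q hq
  · simp [past_of_mem_initTokens h]
  · rw [past_of_mem_postTokens h]
    intro e' he'
    have h' := rank_lt_sizeOf h
    rcases Finset.mem_insert.1 he' with rfl | he'
    · exact h'
    · obtain ⟨r, hr, he'⟩ := Finset.mem_biUnion.1 he'
      exact (ih r hr e' he').trans ((Event.sizeOf_lt_rank hr).trans h')

theorem IsConfig.notMem_eventPast (hC : N.IsConfig ok C) {e : Event P T} (he : e ∈ C) :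
    e ∉ e.past := by
  intro h
  obtain ⟨q, hq, h⟩ := Finset.mem_biUnion.1 h
  have h₁ := hC.rank_lt_of_mem_past (hC.closed e he q hq) e h
  have h₂ := Event.sizeOf_lt_rank hq
  omega

/-- Every event in the past of a token produces that token or one consumed in that past. -/
theorem IsConfig.exists_consumed (hC : N.IsConfig ok C) {q : Token P T} (hq : q ∈ N.tokens C) :
    ∀ e ∈ q.past, q ∈ N.postTokens e ∨ ∃ o ∈ N.postTokens e, ∃ e' ∈ q.past, o ∈ e'.2 := by
  refine hC.token_induction (p := fun q => ∀ e ∈ q.past, q ∈ N.postTokens e ∨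
    ∃ o ∈ N.postTokens e, ∃ e' ∈ q.past, o ∈ e'.2) (fun q h => ?_) (fun e he ih q h => ?_) q hq
  · simp [past_of_mem_initTokens h]
  · rw [past_of_mem_postTokens h]
    intro a ha
    rcases Finset.mem_insert.1 ha with rfl | ha
    · exact Or.inl h
    · obtain ⟨r, hr, ha⟩ := Finset.mem_biUnion.1 ha
      rcases ih r hr a ha with h' | ⟨o, ho, e', he', ho'⟩
      · exact Or.inr ⟨r, h', e, Finset.mem_insert_self _ _, hr⟩
      · exact Or.inr ⟨o, ho, e', Finset.mem_insert_of_mem (Finset.mem_biUnion.2 ⟨r, hr, he'⟩), ho'⟩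

theorem mem_tokens_of_past_subset {q : Token P T}
    (hq : q ∈ N.tokens C) (hD : q.past ⊆ D) : q ∈ N.tokens D := by
  rcases mem_tokens.1 hq with h | ⟨e, -, h⟩
  · exact mem_tokens.2 (Or.inl h)
  · refine mem_tokens.2 (Or.inr ⟨e, hD ?_, h⟩)
    rw [past_of_mem_postTokens h]
    exact Finset.mem_insert_self _ _

theorem IsConfig.of_subset (hC : N.IsConfig ok C) (hD : D ⊆ C) (h : ∀ e ∈ D, e.past ⊆ D) :
    N.IsConfig ok D where
  map_lab e he := hC.map_lab e (hD he)
  ok e he := hC.ok e (hD he)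
  closed e he q hq := mem_tokens_of_past_subset (hC.closed e (hD he) q hq)
    ((Finset.subset_biUnion_of_mem Token.past hq).trans (h e he))
  conflict_free e₁ h₁ e₂ h₂ := hC.conflict_free e₁ (hD h₁) e₂ (hD h₂)

theorem IsConfig.past (hC : N.IsConfig ok C) {q : Token P T} (hq : q ∈ N.tokens C) :
    N.IsConfig ok q.past :=
  hC.of_subset (hC.past_subset hq) (hC.past_trans hq)

theorem IsConfig.eventPast (hC : N.IsConfig ok C) {e : Event P T} (he : e ∈ C) :
    N.IsConfig ok e.past := by
  refine hC.of_subset (hC.eventPast_subset he) fun a ha => ?_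
  obtain ⟨q, hq, ha⟩ := Finset.mem_biUnion.1 ha
  exact (hC.past_trans (hC.closed e he q hq) a ha).trans
    (Finset.subset_biUnion_of_mem Token.past hq)

theorem IsConfig.insert_eventPast (hC : N.IsConfig ok C) {e : Event P T} (he : e ∈ C) :
    N.IsConfig ok (insert e e.past) := by
  obtain ⟨q, hq⟩ := N.postTokens_nonempty e
  rw [← past_of_mem_postTokens hq]
  exact hC.past (mem_tokens.2 (Or.inr ⟨e, he, hq⟩))

theorem IsConfig.mem_cut_past (hC : N.IsConfig ok C) {q : Token P T} (hq : q ∈ N.tokens C) :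
    q ∈ N.cut q.past := by
  refine mem_cut.2 ⟨mem_tokens_of_past_subset hq subset_rfl, fun e he h => ?_⟩
  have h₁ := hC.rank_lt_of_mem_past hq e he
  have h₂ := Event.sizeOf_lt_rank h
  omega

/-- A configuration that strictly contains another one has a last event outside of it. -/
theorem IsConfig.exists_erase (hC : N.IsConfig ok C) (hD : N.IsConfig ok D) (hDC : D ⊂ C) :
    ∃ e ∈ C, e ∉ D ∧ N.IsConfig ok (C.erase e) := by
  obtain ⟨e, he, hmax⟩ := Finset.exists_max_image (C \ D) Event.rank
    (Finset.sdiff_nonempty.2 hDC.2)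
  rw [Finset.mem_sdiff] at he
  refine ⟨e, he.1, he.2, ?_⟩
  refine ⟨fun a ha => hC.map_lab a (Finset.mem_of_mem_erase ha),
    fun a ha => hC.ok a (Finset.mem_of_mem_erase ha), fun a ha q hq => ?_,
    fun a ha b hb => hC.conflict_free a (Finset.mem_of_mem_erase ha) b
      (Finset.mem_of_mem_erase hb)⟩
  have haC := Finset.mem_of_mem_erase ha
  rcases mem_tokens.1 (hC.closed a haC q hq) with h | ⟨b, hb, h⟩
  · exact mem_tokens.2 (Or.inl h)
  · refine mem_tokens.2 (Or.inr ⟨b, Finset.mem_erase.2 ⟨?_, hb⟩, h⟩)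
    rintro rfl
    by_cases haD : a ∈ D
    · rcases mem_tokens.1 (hD.closed a haD q hq) with h' | ⟨b', hb', h'⟩
      · exact notMem_postTokens_of_mem_initTokens h' h
      · exact he.2 (eq_of_mem_postTokens h h' ▸ hb')
    · have h₁ := hmax a (Finset.mem_sdiff.2 ⟨haC, haD⟩)
      have h₂ := Event.sizeOf_lt_rank hq
      have h₃ := rank_lt_sizeOf h
      omega

theorem IsConfig.pre_subset_cut {e : Event P T} (heC : e ∉ C)
    (hi : N.IsConfig ok (insert e C)) : e.2 ⊆ N.cut C := by
  intro q hq
  have hei := Finset.mem_insert_self e C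
  refine mem_cut.2 ⟨?_, fun a ha hqa => ?_⟩
  · rcases mem_tokens.1 (hi.closed e hei q hq) with h | ⟨b, hb, h⟩
    · exact mem_tokens.2 (Or.inl h)
    · rcases Finset.mem_insert.1 hb with rfl | hb
      · have h₂ := Event.sizeOf_lt_rank hq
        have h₃ := rank_lt_sizeOf h
        omega
      · exact mem_tokens.2 (Or.inr ⟨b, hb, h⟩)
  · exact heC (hi.conflict_free e hei a (Finset.mem_insert_of_mem ha) q hq hqa ▸ ha)

theorem disjoint_tokens_postTokens {e : Event P T} (heC : e ∉ C) :
    Disjoint (N.tokens C) (N.postTokens e) := by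
  rw [Finset.disjoint_left]
  intro q hq h
  rcases mem_tokens.1 hq with h' | ⟨b, hb, h'⟩
  · exact notMem_postTokens_of_mem_initTokens h' h
  · exact heC (eq_of_mem_postTokens h' h ▸ hb)

theorem IsConfig.cut_insert {e : Event P T} (heC : e ∉ C) (hC : N.IsConfig ok C) :
    N.cut (insert e C) = N.cut C \ e.2 ∪ N.postTokens e := by
  ext q
  simp only [mem_cut, mem_tokens, Finset.mem_union, Finset.mem_sdiff, Finset.mem_insert]
  constructor
  · rintro ⟨h | ⟨a, rfl | ha, h⟩, h'⟩
    · exact Or.inl ⟨⟨Or.inl h, fun b hb => h' b (Or.inr hb)⟩, h' e (Or.inl rfl)⟩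
    · exact Or.inr h
    · exact Or.inl ⟨⟨Or.inr ⟨a, ha, h⟩, fun b hb => h' b (Or.inr hb)⟩, h' e (Or.inl rfl)⟩
  · rintro (⟨⟨h, h'⟩, h''⟩ | h)
    · refine ⟨h.imp_right fun ⟨a, ha, h⟩ => ⟨a, Or.inr ha, h⟩, ?_⟩
      rintro b (rfl | hb)
      · exact h''
      · exact h' b hb
    · refine ⟨Or.inr ⟨e, Or.inl rfl, h⟩, ?_⟩
      rintro b (rfl | hb) hq
      · have h₂ := Event.sizeOf_lt_rank hq
        have h₃ := rank_lt_sizeOf h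
        omega
      · exact Finset.disjoint_left.1 (disjoint_tokens_postTokens heC) (hC.closed b hb q hq) h

theorem IsConfig.insert {e : Event P T} (hC : N.IsConfig ok C)
    (hlab : e.2.val.map Token.lab = N.pre e.1) (hok : ok e) (hpre : e.2 ⊆ N.cut C) :
    N.IsConfig ok (insert e C) where
  map_lab := Finset.forall_mem_insert _ _ _ |>.2 ⟨hlab, hC.map_lab⟩
  ok := Finset.forall_mem_insert _ _ _ |>.2 ⟨hok, hC.ok⟩
  closed := Finset.forall_mem_insert _ _ _ |>.2
    ⟨fun q hq => tokens_mono (Finset.subset_insert _ _) (cut_subset_tokens (hpre hq)),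
      fun a ha q hq => tokens_mono (Finset.subset_insert _ _) (hC.closed a ha q hq)⟩
  conflict_free a ha b hb q hqa hqb := by
    rcases Finset.mem_insert.1 ha with rfl | ha' <;> rcases Finset.mem_insert.1 hb with rfl | hb'
    · rfl
    · exact absurd hqb ((mem_cut.1 (hpre hqa)).2 b hb')
    · exact absurd hqa ((mem_cut.1 (hpre hqb)).2 a ha')
    · exact hC.conflict_free a ha' b hb' q hqa hqb

theorem IsConfig.fires_insert {e : Event P T} (heC : e ∉ C) (hC : N.IsConfig ok C)
    (hi : N.IsConfig ok (Insert.insert e C)) :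
    N.Fires (N.cutMarking C) e.1 (N.cutMarking (Insert.insert e C)) := by
  have hsub := hi.pre_subset_cut heC
  have hdisj : Disjoint (N.cut C \ e.2) (N.postTokens e) :=
    (disjoint_tokens_postTokens heC).mono_left (Finset.sdiff_subset.trans cut_subset_tokens)
  have hcut : N.cutMarking C = N.pre e.1 + (N.cut C \ e.2).val.map Token.lab := by
    rw [cutMarking, ← hi.map_lab e (Finset.mem_insert_self _ _), ← Multiset.map_add,
      Finset.sdiff_val, add_tsub_cancel_of_le (Finset.val_le_iff.2 hsub)]
  refine ⟨hcut ▸ Multiset.le_add_right _ _, ?_⟩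
  rw [hcut, add_tsub_cancel_left, cutMarking, hC.cut_insert heC, ← Finset.disjUnion_eq_union _ _ hdisj,
    Finset.disjUnion_val, Multiset.map_add, map_lab_postTokens]

theorem IsConfig.reachable (hC : N.IsConfig ok C) : N.Reachable (N.cutMarking C) := by
  induction hn : C.card using Nat.strong_induction_on generalizing C with
  | _ n ih =>
    subst hn
    rcases C.eq_empty_or_nonempty with rfl | hne
    · rw [cutMarking, cut_empty, map_lab_initTokens]
      exact Relation.ReflTransGen.refl
    · obtain ⟨e, he, -, hE⟩ := hC.exists_erase isConfig_empty (Finset.empty_ssubset.2 hne)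
      refine (ih _ (Finset.card_erase_lt_of_mem he) hE rfl).tail ⟨e.1, ?_⟩
      have := hE.fires_insert (Finset.notMem_erase e C) (by rwa [Finset.insert_erase he])
      rwa [Finset.insert_erase he] at this

end PetriNet

namespace PetriGame

variable {P T : Type} [DecidableEq P] {G : PetriGame P T}

/-- A set of vertices of `Graph'(G)` which avoids bad vertices and which Player 0 can enforce
never to leave. -/
structure IsWinningRegion (G : PetriGame P T) (W : Set (GVertex' P T)) : Prop where
  not_bad : ∀ v ∈ W, ¬ GBad' G v
  exists_commit : ∀ M p, (M, none, {p}) ∈ W → ∃ c, (M, some c, {p}) ∈ W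
  step : ∀ M c R w, (M, some c, R) ∈ W → GEdge' G (M, some c, R) w → w ∈ W

theorem HasWinningGraphStrategy'.exists_region (h : G.HasWinningGraphStrategy') :
    ∃ W, G.IsWinningRegion W ∧
      ∃ s₀, G.isSystem s₀ ∧ s₀ ∈ G.net.init ∧ (G.net.init, none, {s₀}) ∈ W := by
  obtain ⟨s₀, hs₀, hmem, σ, hσ, hbad⟩ := h
  refine ⟨{v | ∃ l, ConsistentPlay (GEdge' G) (fun v => v.2.1 = none) σ
    (G.net.init, none, {s₀}) (v :: l)}, ⟨?_, ?_, ?_⟩, s₀, hs₀, hmem, [], .base⟩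
  · rintro v ⟨l, hl⟩
    exact hbad _ v hl (by simp)
  · rintro M p ⟨l, hl⟩
    have he := hσ _ _ hl rfl
    have hp := ConsistentPlay.stepP0 hl rfl he
    generalize σ ((M, none, {p}) :: l) = w at he hp
    generalize hR : ({p} : Multiset P) = R at he hp
    cases he
    exact ⟨_, _, hp⟩
  · rintro M c R w ⟨l, hl⟩ hw
    exact ⟨_, .stepP1 hl (by simp) hw⟩

/-- A commitment that keeps Player 0 in the region `W`. -/
noncomputable def commitment (W : Set (GVertex' P T)) (M : Multiset P) (p : P) : Set T :=
  Classical.epsilon fun c => (M, some c, {p}) ∈ W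

theorem IsWinningRegion.commitment_mem {W : Set (GVertex' P T)} (hW : G.IsWinningRegion W)
    {M : Multiset P} {p : P} (h : (M, none, {p}) ∈ W) : (M, some (commitment W M p), {p}) ∈ W :=
  Classical.epsilon_spec (hW.exists_commit M p h)

/-- The commitment of a system token, determined by its causal past. -/
noncomputable def tokenCommitment (G : PetriGame P T) (W : Set (GVertex' P T))
    (s : Token P T) : Set T :=
  commitment W (G.net.cutMarking s.past) s.lab

/-- An event is admissible if every system token it consumes is committed to it. -/
def Admissible (G : PetriGame P T) (W : Set (GVertex' P T)) (e : Event P T) : Prop :=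
  ∀ s ∈ e.2, G.isSystem s.lab → e.1 ∈ G.tokenCommitment W s

end PetriGame

namespace PetriNet.IsConfig

variable {P T : Type} [DecidableEq P] {G : PetriGame P T} {ok : Event P T → Prop}
  {C D : Finset (Event P T)}

theorem existsUnique_system (hone : G.OneSystemPlayer) (hC : G.net.IsConfig ok C) :
    ∃ s ∈ G.net.cut C, G.isSystem s.lab ∧
      ∀ s' ∈ G.net.cut C, G.isSystem s'.lab → s' = s := by
  obtain ⟨p, hp, hcount, huniq⟩ := hone _ hC.reachable
  have hmem : p ∈ G.net.cutMarking C := Multiset.count_pos.1 (by omega)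
  obtain ⟨s, hs, rfl⟩ := Multiset.mem_map.1 hmem
  refine ⟨s, hs, hp, fun s' hs' hsys => ?_⟩
  have hlab := huniq s'.lab hsys (Multiset.mem_map_of_mem _ hs')
  by_contra hne
  have hle : ({s', s} : Finset (Token P T)).val ≤ (G.net.cut C).val :=
    Finset.val_le_iff.2 (Finset.insert_subset hs' (Finset.singleton_subset_iff.2 hs))
  have := Multiset.count_le_of_le s.lab (Multiset.map_le_map (f := Token.lab) hle)
  rw [Finset.insert_val_of_notMem (by simpa using hne)] at this
  change _ ≤ Multiset.count s.lab (G.net.cutMarking C) at this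
  rw [hcount] at this
  simp [hlab] at this

theorem system_unique (hone : G.OneSystemPlayer) (hC : G.net.IsConfig ok C) {s s' : Token P T}
    (hs : s ∈ G.net.cut C) (hsys : G.isSystem s.lab) (hs' : s' ∈ G.net.cut C)
    (hsys' : G.isSystem s'.lab) : s = s' := by
  obtain ⟨r, -, -, hr⟩ := hC.existsUnique_system hone
  rw [hr s hs hsys, hr s' hs' hsys']

/-- An event consumes a system token if and only if it produces one. -/
theorem exists_system_iff (hone : G.OneSystemPlayer) (hC : G.net.IsConfig ok C)
    {e : Event P T} (he : e ∈ C) :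
    (∃ s ∈ e.2, G.isSystem s.lab) ↔ ∃ s ∈ G.net.postTokens e, G.isSystem s.lab := by
  have hp := hC.eventPast he
  have hi := hC.insert_eventPast he
  have hne := hC.notMem_eventPast he
  have hcut := hp.cut_insert hne
  have hsub := hi.pre_subset_cut hne
  constructor
  · rintro ⟨s, hs, hsys⟩
    obtain ⟨r, hr, hrsys, -⟩ := hi.existsUnique_system hone
    rw [hcut, Finset.mem_union, Finset.mem_sdiff] at hr
    rcases hr with ⟨hr, hrs⟩ | hr
    · exact absurd (hp.system_unique hone (hsub hs) hsys hr hrsys ▸ hs) hrs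
    · exact ⟨r, hr, hrsys⟩
  · rintro ⟨s, hs, hsys⟩
    obtain ⟨r, hr, hrsys, -⟩ := hp.existsUnique_system hone
    refine ⟨r, ?_, hrsys⟩
    by_contra hre
    have h₁ : r ∈ G.net.cut (Insert.insert e e.past) := by
      rw [hcut]; exact Finset.mem_union_left _ (Finset.mem_sdiff.2 ⟨hr, hre⟩)
    have h₂ : s ∈ G.net.cut (Insert.insert e e.past) := by
      rw [hcut]; exact Finset.mem_union_right _ hs
    obtain rfl := hi.system_unique hone h₁ hrsys h₂ hsys
    exact Finset.disjoint_left.1 (disjoint_tokens_postTokens hne) (cut_subset_tokens hr) hs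

theorem pureEnv_iff (hC : G.net.IsConfig ok C) {e : Event P T} (he : e ∈ C) :
    G.PureEnv e.1 ↔ ¬ ∃ s ∈ e.2, G.isSystem s.lab := by
  simp [PetriGame.PureEnv, ← hC.map_lab e he]

/-- Events outside of the past of the system token are purely environmental. -/
theorem pureEnv_of_notMem_past (hone : G.OneSystemPlayer) (hC : G.net.IsConfig ok C)
    {s : Token P T} (hs : s ∈ G.net.cut C) (hsys : G.isSystem s.lab) {e : Event P T}
    (he : e ∈ C) (hes : e ∉ s.past) : G.PureEnv e.1 := by
  rw [hC.pureEnv_iff he]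
  intro h
  classical
  obtain ⟨a, ha, hmax⟩ := Finset.exists_max_image
    {e ∈ C | e ∉ s.past ∧ ∃ s ∈ e.2, G.isSystem s.lab} Event.rank
    ⟨e, Finset.mem_filter.2 ⟨he, hes, h⟩⟩
  obtain ⟨haC, has, hasys⟩ := Finset.mem_filter.1 ha
  obtain ⟨r, hr, hrsys⟩ := (hC.exists_system_iff hone haC).1 hasys
  have hrC : r ∈ G.net.tokens C := mem_tokens.2 (Or.inr ⟨a, haC, hr⟩)
  have har : a ∈ r.past := by
    rw [past_of_mem_postTokens hr]; exact Finset.mem_insert_self _ _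
  by_cases hcons : ∃ b ∈ C, r ∈ b.2
  · obtain ⟨b, hb, hrb⟩ := hcons
    by_cases hbs : b ∈ s.past
    · exact has (hC.past_trans (cut_subset_tokens hs) b hbs (Finset.mem_biUnion.2 ⟨r, hrb, har⟩))
    · have h₁ := hmax b (Finset.mem_filter.2 ⟨hb, hbs, r, hrb, hrsys⟩)
      have h₂ := Event.sizeOf_lt_rank hrb
      have h₃ := rank_lt_sizeOf hr
      omega
  · push Not at hcons
    exact has (hC.system_unique hone hs hsys (mem_cut.2 ⟨hrC, hcons⟩) hrsys ▸ har)

/-- A play at the cut of `D` can be continued to the cut of a larger configuration `C` by purely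
environmental transitions, whatever choice `o` of responsible tokens. -/
theorem exists_mem_region {W : Set (GVertex' P T)} (hW : G.IsWinningRegion W)
    (hD : G.net.IsConfig ok D) {c : Set T} {s : Token P T} (hs : s ∈ G.net.cut D)
    (hmem : (G.net.cutMarking D, some c, {s.lab}) ∈ W) (o : Event P T → Token P T)
    (ho : ∀ e, o e ∈ G.net.postTokens e) (hC : G.net.IsConfig ok C) (hDC : D ⊆ C)
    (henv : ∀ e ∈ C, e ∉ D → G.PureEnv e.1) :
    ∃ R, (G.net.cutMarking C, some c, R) ∈ W ∧
      R ≤ (G.net.cut C ∩ Insert.insert s ((C \ D).image o)).val.map Token.lab := by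
  induction hn : C.card using Nat.strong_induction_on generalizing C with
  | _ n ih =>
    subst hn
    rcases hDC.eq_or_ssubset with rfl | hss
    · refine ⟨_, hmem, ?_⟩
      simp [hs]
    obtain ⟨e, he, heD, hE⟩ := hC.exists_erase hD hss
    have heE := Finset.notMem_erase e C
    have hie : Insert.insert e (C.erase e) = C := Finset.insert_erase he
    obtain ⟨R, hR, hle⟩ := ih _ (Finset.card_erase_lt_of_mem he) hE
      (Finset.subset_erase.2 ⟨hDC, heD⟩)
      (fun a ha => henv a (Finset.mem_of_mem_erase ha)) rfl
    have hfires := hE.fires_insert heE (hie.symm ▸ hC)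
    have hcut := hE.cut_insert heE
    rw [hie] at hfires hcut
    refine ⟨_, hW.step _ _ _ _ hR (GEdge'.e2 (o := (o e).lab) (henv e he heD) hfires ?_), ?_⟩
    · rw [← map_lab_postTokens]
      exact Multiset.mem_map_of_mem _ (ho e)
    set X := G.net.cut (C.erase e) ∩ Insert.insert s ((C.erase e \ D).image o)
    have hoe : o e ∉ X \ e.2 := fun h =>
      Finset.disjoint_left.1 (disjoint_tokens_postTokens heE)
        (cut_subset_tokens (Finset.mem_inter.1 (Finset.mem_sdiff.1 h).1).1) (ho e)
    have hsub : Insert.insert (o e) (X \ e.2) ⊆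
        G.net.cut C ∩ Insert.insert s ((C \ D).image o) := by
      refine Finset.insert_subset ?_ ?_
      · rw [hcut, Finset.mem_inter]
        exact ⟨Finset.mem_union_right _ (ho e), Finset.mem_insert_of_mem
          (Finset.mem_image_of_mem _ (Finset.mem_sdiff.2 ⟨he, heD⟩))⟩
      · rw [hcut]
        intro q hq
        obtain ⟨hqX, hqe⟩ := Finset.mem_sdiff.1 hq
        obtain ⟨hq₁, hq₂⟩ := Finset.mem_inter.1 hqX
        refine Finset.mem_inter.2
          ⟨Finset.mem_union_left _ (Finset.mem_sdiff.2 ⟨hq₁, hqe⟩), ?_⟩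
        exact Finset.insert_subset_insert _ (Finset.image_subset_image
          (Finset.sdiff_subset_sdiff (Finset.erase_subset _ _) subset_rfl)) hq₂
    refine le_trans ?_ (Multiset.map_le_map (f := Token.lab) (Finset.val_le_iff.2 hsub))
    rw [Finset.insert_val_of_notMem hoe, Multiset.map_cons, ← Multiset.singleton_add,
      add_comm {(o e).lab}]
    refine add_le_add_left ?_ _
    rw [tsub_le_iff_right, ← hC.map_lab e he, ← Multiset.map_add]
    refine hle.trans (Multiset.map_le_map ?_)
    rw [Finset.sdiff_val]
    exact le_tsub_add

theorem initial_mem_region (hone : G.OneSystemPlayer) {W : Set (GVertex' P T)}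
    (hW : G.IsWinningRegion W) {s₀ : P} (hs₀ : G.isSystem s₀) (hs₀init : s₀ ∈ G.net.init)
    (hinit : (G.net.init, none, {s₀}) ∈ W) {s : Token P T} (hsys : G.isSystem s.lab)
    (hC : G.net.IsConfig (G.Admissible W) C) (hs : s ∈ G.net.cut C) :
    (G.net.cutMarking s.past, none, {s.lab}) ∈ W := by
  induction hn : sizeOf s using Nat.strong_induction_on generalizing s C with
  | _ n ih =>
    subst hn
    have hsC := cut_subset_tokens hs
    rcases mem_tokens.1 hsC with h | ⟨e, he, h⟩
    · rw [past_of_mem_initTokens h, cutMarking, cut_empty, map_lab_initTokens]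
      have hmem : s₀ ∈ G.net.initTokens.val.map Token.lab := by rwa [map_lab_initTokens]
      obtain ⟨r, hr, rfl⟩ := Multiset.mem_map.1 hmem
      have h₀ : G.net.IsConfig (G.Admissible W) ∅ := isConfig_empty
      rwa [h₀.system_unique hone (by rwa [cut_empty]) hsys (by rwa [cut_empty]) hs₀]
    · have hp := hC.eventPast he
      have hi := hC.insert_eventPast he
      have hne := hC.notMem_eventPast he
      obtain ⟨r, hr, hrsys⟩ := (hC.exists_system_iff hone he).2 ⟨s, h, hsys⟩
      have hrcut := hi.pre_subset_cut hne hr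
      have hrtok := cut_subset_tokens hrcut
      have hrW := hW.commitment_mem
        (ih _ ((Event.sizeOf_lt_rank hr).trans (rank_lt_sizeOf h)) hrsys hp hrcut rfl)
      have ho : ∀ a : Event P T, ∃ o ∈ G.net.postTokens a, a ∈ e.past →
          o ∈ e.2 ∨ ∃ b ∈ e.past, o ∈ b.2 := by
        intro a
        by_cases ha : a ∈ e.past
        · obtain ⟨q, hq, haq⟩ := Finset.mem_biUnion.1 ha
          have hqC := hC.closed e he q hq
          rcases hC.exists_consumed hqC a haq with h' | ⟨o, ho, b, hb, hob⟩
          · exact ⟨q, h', fun _ => Or.inl hq⟩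
          · exact ⟨o, ho, fun _ => Or.inr ⟨b, Finset.mem_biUnion.2 ⟨q, hq, hb⟩, hob⟩⟩
        · obtain ⟨o, ho⟩ := G.net.postTokens_nonempty a
          exact ⟨o, ho, fun h => absurd h ha⟩
      choose o ho hoc using ho
      obtain ⟨R, hR, hle⟩ := exists_mem_region hW (hp.past hrtok) (hp.mem_cut_past hrtok) hrW o ho
        hp (hp.past_subset hrtok) fun a ha har => hp.pureEnv_of_notMem_past hone hrcut hrsys ha har
      have hfires := hp.fires_insert hne hi
      rw [← past_of_mem_postTokens h] at hfires
      refine hW.step _ _ _ _ hR (GEdge'.e3 ?_ (hC.ok e he r hr hrsys) hfires ?_ hsys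
        (Multiset.mem_map_of_mem _ (hC.mem_cut_past hsC)))
      · refine ⟨r.lab, ?_, hrsys⟩
        rw [← hC.map_lab e he]
        exact Multiset.mem_map_of_mem _ hr
      · rw [← hC.map_lab e he]
        refine hle.trans (Multiset.map_le_map (Finset.val_le_iff.2 fun q hq => ?_))
        obtain ⟨hq₁, hq₂⟩ := Finset.mem_inter.1 hq
        rcases Finset.mem_insert.1 hq₂ with rfl | hq₂
        · exact hr
        · obtain ⟨a, ha, rfl⟩ := Finset.mem_image.1 hq₂
          rcases hoc a (Finset.mem_sdiff.1 ha).1 with h' | ⟨b, hb, h'⟩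
          · exact h'
          · exact absurd h' ((mem_cut.1 hq₁).2 b hb)

/-- Every cut of admissible events is visited in the winning region, under the commitment of its
system token. -/
theorem not_bad (hone : G.OneSystemPlayer) {W : Set (GVertex' P T)}
    (hW : G.IsWinningRegion W) {s₀ : P} (hs₀ : G.isSystem s₀) (hs₀init : s₀ ∈ G.net.init)
    (hinit : (G.net.init, none, {s₀}) ∈ W) {s : Token P T} (hsys : G.isSystem s.lab)
    (hC : G.net.IsConfig (G.Admissible W) C) (hs : s ∈ G.net.cut C) :
    ¬ GBad G (G.net.cutMarking C, some (G.tokenCommitment W s)) := by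
  have hsC := cut_subset_tokens hs
  choose o ho using postTokens_nonempty (N := G.net)
  obtain ⟨R, hR, -⟩ := exists_mem_region hW (hC.past hsC) (hC.mem_cut_past hsC)
    (hW.commitment_mem (hC.initial_mem_region hone hW hs₀ hs₀init hinit hsys hs)) o ho
    hC (hC.past_subset hsC) fun a ha has => hC.pureEnv_of_notMem_past hone hs hsys ha has
  exact hW.not_bad _ hR

end PetriNet.IsConfig

namespace PetriNet

variable {P T : Type} [DecidableEq P] {N : PetriNet P T} {ok : Event P T → Prop}
  {C D : Finset (Event P T)}

/-- The events that belong to some configuration. -/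
def IsEvent (N : PetriNet P T) (ok : Event P T → Prop) (e : Event P T) : Prop :=
  ∃ C, N.IsConfig ok C ∧ e ∈ C

/-- The tokens that are initial or produced in some configuration. -/
def IsToken (N : PetriNet P T) (ok : Event P T → Prop) (q : Token P T) : Prop :=
  ∃ C, N.IsConfig ok C ∧ q ∈ N.tokens C

theorem IsEvent.isToken_of_mem_pre {e : Event P T} (he : N.IsEvent ok e) {q : Token P T}
    (hq : q ∈ e.2) : N.IsToken ok q :=
  let ⟨C, hC, he⟩ := he
  ⟨C, hC, hC.closed e he q hq⟩

theorem IsEvent.isToken_of_mem_post {e : Event P T} (he : N.IsEvent ok e) {q : Token P T}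
    (hq : q ∈ N.postTokens e) : N.IsToken ok q :=
  let ⟨C, hC, he⟩ := he
  ⟨C, hC, mem_tokens.2 (Or.inr ⟨e, he, hq⟩)⟩

theorem isToken_of_mem_initTokens {q : Token P T} (hq : q ∈ N.initTokens) : N.IsToken ok q :=
  ⟨∅, isConfig_empty, mem_tokens.2 (Or.inl hq)⟩

theorem IsEvent.map_lab {e : Event P T} (he : N.IsEvent ok e) :
    e.2.val.map Token.lab = N.pre e.1 :=
  let ⟨_, hC, he⟩ := he
  hC.map_lab e he

theorem IsEvent.admissible {e : Event P T} (he : N.IsEvent ok e) : ok e :=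
  let ⟨_, hC, he⟩ := he
  hC.ok e he

theorem IsEvent.pre_nonempty {e : Event P T} (he : N.IsEvent ok e) : e.2.Nonempty := by
  rw [Finset.nonempty_iff_ne_empty]
  intro h
  apply N.pre_ne e.1
  rw [← he.map_lab, h]
  rfl

variable (N ok) in
/-- The places of the restricted unfolding lying in a given finite set of tokens. -/
noncomputable def restrict (s : Finset (Token P T)) : Multiset {q // N.IsToken ok q} :=
  (@Finset.subtype _ (N.IsToken ok) (Classical.decPred _) s).val

theorem restrict_nodup (s : Finset (Token P T)) : (N.restrict ok s).Nodup :=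
  Finset.nodup _

theorem mem_restrict {s : Finset (Token P T)} {q : {q // N.IsToken ok q}} :
    q ∈ N.restrict ok s ↔ q.1 ∈ s :=
  @Finset.mem_subtype _ _ (Classical.decPred _) _ _

theorem map_val_restrict {s : Finset (Token P T)} (hs : ∀ q ∈ s, N.IsToken ok q) :
    (N.restrict ok s).map Subtype.val = s.val := by
  have := congrArg Finset.val (@Finset.subtype_map_of_mem _ _ (Classical.decPred _) s hs)
  rwa [Finset.map_val] at this

theorem map_restrict {s : Finset (Token P T)} (hs : ∀ q ∈ s, N.IsToken ok q) :
    ((N.restrict ok s).map fun q => q.1.lab) = s.val.map Token.lab := by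
  rw [← map_val_restrict hs, Multiset.map_map]
  rfl

variable (N ok) in
/-- The unfolding of a net restricted to admissible events. -/
noncomputable def unfolding : PetriNet {q // N.IsToken ok q} {e // N.IsEvent ok e} where
  pre e := N.restrict ok e.1.2
  post e := N.restrict ok (N.postTokens e.1)
  init := N.restrict ok N.initTokens
  pre_ne e h := by
    obtain ⟨q, hq⟩ := e.2.pre_nonempty
    exact Multiset.notMem_zero (⟨q, e.2.isToken_of_mem_pre hq⟩ : {q // N.IsToken ok q})
      (h ▸ mem_restrict.2 hq)
  post_ne e h := by
    obtain ⟨q, hq⟩ := N.postTokens_nonempty e.1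
    exact Multiset.notMem_zero (⟨q, e.2.isToken_of_mem_post hq⟩ : {q // N.IsToken ok q})
      (h ▸ mem_restrict.2 hq)

theorem mem_unfolding_pre {e : {e // N.IsEvent ok e}} {q : {q // N.IsToken ok q}} :
    q ∈ (N.unfolding ok).pre e ↔ q.1 ∈ e.1.2 :=
  mem_restrict

theorem mem_unfolding_post {e : {e // N.IsEvent ok e}} {q : {q // N.IsToken ok q}} :
    q ∈ (N.unfolding ok).post e ↔ q.1 ∈ N.postTokens e.1 :=
  mem_restrict

theorem mem_unfolding_init {q : {q // N.IsToken ok q}} :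
    q ∈ (N.unfolding ok).init ↔ q.1 ∈ N.initTokens :=
  mem_restrict

theorem map_val_unfolding_pre (e : {e // N.IsEvent ok e}) :
    ((N.unfolding ok).pre e).map Subtype.val = e.1.2.val :=
  map_val_restrict fun _ => e.2.isToken_of_mem_pre

theorem map_val_unfolding_post (e : {e // N.IsEvent ok e}) :
    ((N.unfolding ok).post e).map Subtype.val = (N.postTokens e.1).val :=
  map_val_restrict fun _ => e.2.isToken_of_mem_post

theorem map_val_unfolding_init :
    (N.unfolding ok).init.map Subtype.val = N.initTokens.val :=
  map_val_restrict fun _ => isToken_of_mem_initTokens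

/-- Configurations are closed under causal predecessors. -/
theorem IsConfig.mem_of_cLe (hC : N.IsConfig ok C)
    {x y : {q // N.IsToken ok q} ⊕ {e // N.IsEvent ok e}} (h : (N.unfolding ok).CLe x y)
    (hy : Sum.elim (fun q => q.1 ∈ N.tokens C) (fun e => e.1 ∈ C) y) :
    Sum.elim (fun q => q.1 ∈ N.tokens C) (fun e => e.1 ∈ C) x := by
  induction h using Relation.ReflTransGen.head_induction_on with
  | refl => exact hy
  | head hab _ ih =>
    rename_i a b _
    match a, b, hab, ih with
    | .inl q, .inr e, hab, ih => exact hC.closed _ ih _ (mem_unfolding_pre.1 hab)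
    | .inr e, .inl q, hab, ih =>
      have hq := mem_unfolding_post.1 hab
      rcases mem_tokens.1 ih with h | ⟨e', he', h⟩
      · exact absurd hq (notMem_postTokens_of_mem_initTokens h)
      · obtain rfl := eq_of_mem_postTokens h hq
        exact he'

/-- The past of a token consists of causal predecessors. -/
theorem IsConfig.cLe_of_mem_past (hC : N.IsConfig ok C) {q : Token P T} (hq : q ∈ N.tokens C) :
    ∀ (hq' : N.IsToken ok q), ∀ e ∈ q.past, ∀ he : N.IsEvent ok e,
      (N.unfolding ok).CLe (Sum.inr ⟨e, he⟩) (Sum.inl ⟨q, hq'⟩) := by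
  refine hC.token_induction (p := fun q => ∀ (hq' : N.IsToken ok q), ∀ e ∈ q.past,
    ∀ he : N.IsEvent ok e, (N.unfolding ok).CLe (Sum.inr ⟨e, he⟩) (Sum.inl ⟨q, hq'⟩))
    (fun q h => ?_) (fun e he ih q h => ?_) q hq
  · simp [past_of_mem_initTokens h]
  · rw [past_of_mem_postTokens h]
    intro hq' a ha ha'
    have he' : N.IsEvent ok e := ⟨C, hC, he⟩
    have hflow : (N.unfolding ok).Flow (Sum.inr ⟨e, he'⟩) (Sum.inl ⟨q, hq'⟩) :=
      mem_unfolding_post.2 h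
    rcases Finset.mem_insert.1 ha with rfl | ha
    · exact Relation.ReflTransGen.single hflow
    · obtain ⟨r, hr, har⟩ := Finset.mem_biUnion.1 ha
      have hflow' : (N.unfolding ok).Flow (Sum.inl ⟨r, he'.isToken_of_mem_pre hr⟩)
          (Sum.inr ⟨e, he'⟩) := mem_unfolding_pre.2 hr
      exact ((ih r hr _ a har ha').tail hflow').tail hflow

theorem unfolding_isOccurrence : (N.unfolding ok).IsOccurrence where
  pre_nodup _ := restrict_nodup _
  post_nodup _ := restrict_nodup _
  unique_pre _ _ _ h₁ h₂ :=
    Subtype.ext (eq_of_mem_postTokens (mem_unfolding_post.1 h₁) (mem_unfolding_post.1 h₂))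
  init_nodup := restrict_nodup _
  mem_init q := by
    rw [mem_unfolding_init]
    refine ⟨fun h e he => notMem_postTokens_of_mem_initTokens h (mem_unfolding_post.1 he),
      fun h => ?_⟩
    obtain ⟨C, hC, hq⟩ := q.2
    rcases mem_tokens.1 hq with hq | ⟨e, he, hq⟩
    · exact hq
    · exact (h ⟨e, C, hC, he⟩ (mem_unfolding_post.2 hq)).elim
  wf := by
    refine Subrelation.wf (r := InvImage (· < ·)
      (Sum.elim (fun q => sizeOf q.1) (fun e => e.1.rank))) ?_ (InvImage.wf _ wellFounded_lt)
    intro a b hab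
    match a, b, hab with
    | .inl q, .inr e, hab => exact Event.sizeOf_lt_rank (mem_unfolding_pre.1 hab)
    | .inr e, .inl q, hab => exact rank_lt_sizeOf (mem_unfolding_post.1 hab)
  no_self_conflict := by
    rintro ⟨e, he⟩ ⟨q, -, -, t₁, t₂, hne, hq₁, hq₂, h₁, h₂⟩
    obtain ⟨C, hC, heC⟩ := he
    exact hne (Subtype.ext (hC.conflict_free _ (hC.mem_of_cLe h₁ heC) _ (hC.mem_of_cLe h₂ heC) q.1
      (mem_unfolding_pre.1 hq₁) (mem_unfolding_pre.1 hq₂)))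

theorem unfolding_isBranchingProcess :
    IsBranchingProcess (N.unfolding ok) N (fun q => q.1.lab) (fun e => e.1.1) where
  occ := unfolding_isOccurrence
  map_pre e := (map_restrict fun _ => e.2.isToken_of_mem_pre).trans e.2.map_lab
  map_post e := (map_restrict fun _ => e.2.isToken_of_mem_post).trans (map_lab_postTokens _)
  map_init := (map_restrict fun _ => isToken_of_mem_initTokens).trans map_lab_initTokens
  trans_inj e₁ e₂ hpre hT := by
    refine Subtype.ext (Prod.ext hT (Finset.val_inj.1 ?_))
    rw [← map_val_unfolding_pre, ← map_val_unfolding_pre, hpre]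

/-- Pairwise concurrent places lie in a common cut. -/
theorem exists_cut_of_concurrent {S : Finset {q // N.IsToken ok q}}
    (hS : ∀ p ∈ S, ∀ q ∈ S, p ≠ q → (N.unfolding ok).Concurrent (Sum.inl p) (Sum.inl q)) :
    ∃ C, N.IsConfig ok C ∧ ∀ p ∈ S, p.1 ∈ N.cut C := by
  have hmem : ∀ {e}, e ∈ S.biUnion (fun p => p.1.past) ↔ ∃ p ∈ S, e ∈ p.1.past :=
    Finset.mem_biUnion
  have hsub : ∀ p ∈ S, p.1.past ⊆ S.biUnion fun p => p.1.past := fun p hp e he =>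
    hmem.2 ⟨p, hp, he⟩
  have hconf : N.IsConfig ok (S.biUnion fun p => p.1.past) := by
    have hpast : ∀ p ∈ S, N.IsConfig ok p.1.past := fun p _ =>
      let ⟨_, hC, hp⟩ := p.2
      hC.past hp
    refine ⟨fun e he => ?_, fun e he => ?_, fun e he q hq => ?_, fun e₁ h₁ e₂ h₂ q hq₁ hq₂ => ?_⟩
    · obtain ⟨p, hp, he⟩ := hmem.1 he
      exact (hpast p hp).map_lab e he
    · obtain ⟨p, hp, he⟩ := hmem.1 he
      exact (hpast p hp).ok e he
    · obtain ⟨p, hp, he⟩ := hmem.1 he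
      exact tokens_mono (hsub p hp) ((hpast p hp).closed e he q hq)
    · obtain ⟨p₁, hp₁, h₁⟩ := hmem.1 h₁
      obtain ⟨p₂, hp₂, h₂⟩ := hmem.1 h₂
      by_cases hp : p₁ = p₂
      · subst hp
        exact (hpast p₁ hp₁).conflict_free e₁ h₁ e₂ h₂ q hq₁ hq₂
      by_contra hne
      obtain ⟨C₁, hC₁, hpC₁⟩ := p₁.2
      obtain ⟨C₂, hC₂, hpC₂⟩ := p₂.2
      have he₁ : N.IsEvent ok e₁ := ⟨_, hpast p₁ hp₁, h₁⟩
      have he₂ : N.IsEvent ok e₂ := ⟨_, hpast p₂ hp₂, h₂⟩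
      have hr₁ := hC₁.rank_lt_of_mem_past hpC₁ e₁ h₁
      have hr₂ := hC₂.rank_lt_of_mem_past hpC₂ e₂ h₂
      have hs₁ := Event.sizeOf_lt_rank hq₁
      have hs₂ := Event.sizeOf_lt_rank hq₂
      refine (hS p₁ hp₁ p₂ hp₂ hp).2.2 ⟨⟨q, he₁.isToken_of_mem_pre hq₁⟩, ?_, ?_, ⟨e₁, he₁⟩,
        ⟨e₂, he₂⟩, fun h => hne (congrArg Subtype.val h), mem_unfolding_pre.2 hq₁,
        mem_unfolding_pre.2 hq₂, hC₁.cLe_of_mem_past hpC₁ _ e₁ h₁ _,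
        hC₂.cLe_of_mem_past hpC₂ _ e₂ h₂ _⟩
      · rintro h
        obtain rfl := Sum.inl.inj h
        exact absurd (hs₁.trans hr₁) (lt_irrefl _)
      · rintro h
        obtain rfl := Sum.inl.inj h
        exact absurd (hs₂.trans hr₂) (lt_irrefl _)
  refine ⟨_, hconf, fun p hp => mem_cut.2 ⟨?_, fun e he hpe => ?_⟩⟩
  · obtain ⟨C, hC, hpC⟩ := p.2
    exact mem_tokens_of_past_subset hpC (hsub p hp)
  · obtain ⟨r, hr, her⟩ := hmem.1 he
    obtain ⟨C, hC, hrC⟩ := r.2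
    by_cases hpr : p = r
    · subst hpr
      exact lt_irrefl _ ((Event.sizeOf_lt_rank hpe).trans (hC.rank_lt_of_mem_past hrC e her))
    · have he' : N.IsEvent ok e := ⟨_, hconf, he⟩
      have hflow : (N.unfolding ok).Flow (Sum.inl p) (Sum.inr ⟨e, he'⟩) :=
        mem_unfolding_pre.2 hpe
      exact (hS p hp r hr hpr).1 ((hC.cLe_of_mem_past hrC _ e her he').head hflow)

theorem mem_cut_of_map_eq {M : Multiset {q // N.IsToken ok q}}
    (hM : M.map Subtype.val = (N.cut C).val) {q : {q // N.IsToken ok q}} :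
    q ∈ M ↔ q.1 ∈ N.cut C := by
  rw [← Finset.mem_val, ← hM, Multiset.mem_map_of_injective Subtype.val_injective]

theorem pre_subset_of_enabled {M : Multiset {q // N.IsToken ok q}}
    (hM : M.map Subtype.val = (N.cut C).val) {e : {e // N.IsEvent ok e}}
    (h : (N.unfolding ok).Enabled M e) : e.1.2 ⊆ N.cut C := by
  rw [← Finset.val_le_iff, ← hM, ← map_val_unfolding_pre]
  exact Multiset.map_le_map h

theorem enabled_of_pre_subset {M : Multiset {q // N.IsToken ok q}}
    (hM : M.map Subtype.val = (N.cut C).val) {e : {e // N.IsEvent ok e}}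
    (h : e.1.2 ⊆ N.cut C) : (N.unfolding ok).Enabled M e :=
  (Multiset.le_iff_subset (restrict_nodup _)).2 fun _ hq =>
    (mem_cut_of_map_eq hM).2 (h (mem_unfolding_pre.1 hq))

/-- Reachable markings of the unfolding are cuts of configurations. -/
theorem exists_config_of_reachable [DecidableEq {q // N.IsToken ok q}]
    {M : Multiset {q // N.IsToken ok q}}
    (hM : (N.unfolding ok).Reachable M) :
    ∃ C, N.IsConfig ok C ∧ M.map Subtype.val = (N.cut C).val := by
  induction hM with
  | refl => exact ⟨∅, isConfig_empty, by rw [cut_empty, map_val_unfolding_init]⟩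
  | tail _ hstep ih =>
    obtain ⟨C, hC, hMC⟩ := ih
    obtain ⟨e, hle, rfl⟩ := hstep
    have hsub := pre_subset_of_enabled hMC hle
    have heC : e.1 ∉ C := fun h =>
      let ⟨q, hq⟩ := e.2.pre_nonempty
      (mem_cut.1 (hsub hq)).2 _ h hq
    refine ⟨_, hC.insert e.2.map_lab e.2.admissible hsub, ?_⟩
    have hdisj : Disjoint (N.cut C \ e.1.2) (N.postTokens e.1) :=
      (disjoint_tokens_postTokens heC).mono_left (Finset.sdiff_subset.trans cut_subset_tokens)
    obtain ⟨K, rfl⟩ := Multiset.le_iff_exists_add.1 hle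
    rw [hC.cut_insert heC, ← Finset.disjUnion_eq_union _ _ hdisj, Finset.disjUnion_val,
      Finset.sdiff_val, ← hMC, add_tsub_cancel_left, Multiset.map_add, Multiset.map_add,
      map_val_unfolding_pre, map_val_unfolding_post, add_tsub_cancel_left]

end PetriNet

theorem Finset.exists_subset_map_eq_of_le {α β : Type*} [DecidableEq α] {s : Finset α}
    {f : α → β} {m : Multiset β} (h : m ≤ s.val.map f) :
    ∃ t ⊆ s, t.val.map f = m := by
  induction m using Multiset.induction_on with
  | empty => exact ⟨∅, Finset.empty_subset _, rfl⟩
  | cons b m ih =>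
    obtain ⟨t, hts, rfl⟩ := ih ((Multiset.le_cons_self m b).trans h)
    have hb : b ∈ (s \ t).val.map f := by
      have h' : s.val.map f = (s \ t).val.map f + t.val.map f := by
        rw [← Multiset.map_add, Finset.sdiff_val, tsub_add_cancel_of_le (Finset.val_le_iff.2 hts)]
      rw [h', ← Multiset.singleton_add, add_le_add_iff_right] at h
      exact Multiset.singleton_le.1 h
    obtain ⟨a, ha, rfl⟩ := Multiset.mem_map.1 hb
    obtain ⟨has, hat⟩ := Finset.mem_sdiff.1 ha
    exact ⟨insert a t, Finset.insert_subset has hts, by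
      rw [Finset.insert_val_of_notMem hat, Multiset.map_cons]⟩

/-- If no cut of admissible events is bad under the commitment of its system token, then the unfolding
restricted to admissible events is a winning strategy. -/
theorem PetriGame.isWinningStrategy_unfolding {P T : Type} [DecidableEq P] {G : PetriGame P T}
    (hone : G.OneSystemPlayer) {W : Set (GVertex' P T)}
    [DecidableEq {q // G.net.IsToken (G.Admissible W) q}]
    (hbad : ∀ C, G.net.IsConfig (G.Admissible W) C → ∀ s ∈ G.net.cut C, G.isSystem s.lab →
      ¬ GBad G (G.net.cutMarking C, some (G.tokenCommitment W s))) :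
    G.IsWinningStrategy (G.net.unfolding (G.Admissible W)) (fun q => q.1.lab)
      (fun e => e.1.1) := by
  have hmark : ∀ M, (G.net.unfolding (G.Admissible W)).Reachable M →
      ∃ C, G.net.IsConfig (G.Admissible W) C ∧ M.map Subtype.val = (G.net.cut C).val ∧
        (M.map fun q => q.1.lab) = G.net.cutMarking C := by
    intro M hM
    obtain ⟨C, hC, hMC⟩ := PetriNet.exists_config_of_reachable hM
    refine ⟨C, hC, hMC, ?_⟩
    rw [PetriNet.cutMarking, ← hMC, Multiset.map_map]
    rfl
  refine ⟨PetriNet.unfolding_isBranchingProcess, ?_, ?_, ?_, ?_⟩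
  · intro S t hnd hconc hmap hno
    by_contra! hcon
    obtain ⟨C, hC, hS⟩ := PetriNet.exists_cut_of_concurrent (S := ⟨S, hnd⟩) hconc
    have hSval : (S.map Subtype.val).Nodup := hnd.map Subtype.val_injective
    have hi := hC.insert (e := (t, ⟨S.map Subtype.val, hSval⟩)) ?_ ?_ ?_
    · refine hno ⟨⟨_, _, hi, Finset.mem_insert_self _ _⟩, rfl,
        Multiset.map_injective Subtype.val_injective ?_⟩
      rw [PetriNet.map_val_unfolding_pre]
    · rw [← hmap, Multiset.map_map]
      rfl
    · intro s hs hsys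
      obtain ⟨q, hq, rfl⟩ := Multiset.mem_map.1 hs
      obtain ⟨e, he, rfl⟩ := hcon q hq hsys
      exact e.2.admissible _ (PetriNet.mem_unfolding_pre.1 he) hsys
    · intro s hs
      obtain ⟨q, hq, rfl⟩ := Multiset.mem_map.1 hs
      exact hS q hq
  · intro M hM hMbad
    obtain ⟨C, hC, -, hlab⟩ := hmark M hM
    obtain ⟨s, hs, hsys, -⟩ := hC.existsUnique_system hone
    exact hbad C hC s hs hsys (Or.inl (hlab ▸ hMbad))
  · intro s hsys M hM hsM e₁ e₂ hs₁ hs₂ hen₁ hen₂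
    obtain ⟨C, hC, hMC, -⟩ := hmark M hM
    have hs := (PetriNet.mem_cut_of_map_eq hMC).1 hsM
    have hsub₁ := PetriNet.pre_subset_of_enabled hMC hen₁
    have hsub₂ := PetriNet.pre_subset_of_enabled hMC hen₂
    have hc₁ := e₁.2.admissible _ (PetriNet.mem_unfolding_pre.1 hs₁) hsys
    have hc₂ := e₂.2.admissible _ (PetriNet.mem_unfolding_pre.1 hs₂) hsys
    have hE₁ : G.net.Enabled (G.net.cutMarking C) e₁.1.1 := by
      rw [PetriNet.Enabled, ← e₁.2.map_lab]
      exact Multiset.map_le_map (Finset.val_le_iff.2 hsub₁)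
    have hE₂ : G.net.Enabled (G.net.cutMarking C) e₂.1.1 := by
      rw [PetriNet.Enabled, ← e₂.2.map_lab]
      exact Multiset.map_le_map (Finset.val_le_iff.2 hsub₂)
    by_contra hne
    refine hbad C hC s.1 hs hsys (Or.inr ?_)
    by_cases hT : e₁.1.1 = e₂.1.1
    · have hcard : e₂.1.2.card ≤ e₁.1.2.card := by
        have := congrArg Multiset.card (e₁.2.map_lab.trans
          ((congrArg G.net.pre hT).trans e₂.2.map_lab.symm))
        simpa using this.ge
      have hnsub : ¬ e₁.1.2 ⊆ e₂.1.2 := fun h =>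
        hne (Subtype.ext (Prod.ext hT (Finset.eq_of_subset_of_card_le h hcard)))
      obtain ⟨q, hq₁, hq₂⟩ := Finset.not_subset.1 hnsub
      refine Or.inr (Or.inl ⟨_, hc₁, hE₁, q.lab, ?_, ?_⟩)
      · rw [← e₁.2.map_lab]
        exact Multiset.count_pos.2 (Multiset.mem_map_of_mem _ hq₁)
      · have hle := Multiset.count_le_of_le q.lab (Multiset.map_le_map (f := Token.lab)
          (Finset.val_le_iff.2 (Finset.insert_subset (hsub₁ hq₁) hsub₂)))
        rw [Finset.insert_val_of_notMem hq₂, Multiset.map_cons, Multiset.count_cons_self,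
          e₂.2.map_lab, ← hT] at hle
        exact hle
    · exact Or.inl ⟨_, hc₁, _, hc₂, hT, hE₁, hE₂⟩
  · intro M hM hex
    obtain ⟨C, hC, hMC, hlab⟩ := hmark M hM
    obtain ⟨s, hs, hsys, huniq⟩ := hC.existsUnique_system hone
    rw [hlab] at hex
    have hlive : ∃ t, G.net.Enabled (G.net.cutMarking C) t ∧
        (G.SysTrans t → t ∈ G.tokenCommitment W s) := by
      by_contra! hcon
      exact hbad C hC s hs hsys (Or.inr (Or.inr (Or.inr ⟨hex, hcon⟩)))
    obtain ⟨t, hen, ht⟩ := hlive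
    obtain ⟨S, hS, hmap⟩ := Finset.exists_subset_map_eq_of_le hen
    have hi := hC.insert (e := (t, S)) hmap (fun q hq hqsys => ?_) hS
    · exact ⟨⟨(t, S), _, hi, Finset.mem_insert_self _ _⟩, PetriNet.enabled_of_pre_subset hMC hS⟩
    · obtain rfl := huniq q (hS hq) hqsys
      exact ht ⟨q.lab, hmap ▸ Multiset.mem_map_of_mem _ hq, hqsys⟩

/-- If Player 0 has a winning strategy in the graph game `Graph'(G)` of a
bounded Petri game with one system player, then the Petri game `G` has a
winning, deadlock-avoiding strategy. -/
theorem graphGame'_to_petriGame {P T : Type} [DecidableEq P] [Finite P] [Finite T]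
    (G : PetriGame P T) (hbounded : G.Bounded) (hone : G.OneSystemPlayer)
    (h : G.HasWinningGraphStrategy') :
    G.HasWinningStrategy := by
  obtain ⟨W, hW, s₀, hs₀, hs₀init, hinit⟩ := h.exists_region
  exact ⟨_, _, Classical.decEq _, _, _, _,
    @PetriGame.isWinningStrategy_unfolding _ _ _ _ hone W (Classical.decEq _)
      fun C hC s hs hsys => hC.not_bad hone hW hs₀ hs₀init hinit hsys hs⟩
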